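/- Fix J ≥ 0 and two distinct site indices i ≠ j. For Lebesgue-almost every h ∈ ℝ, the two-point correlation function factorizes in the thermodynamic limit: lim_{N→∞, N > max(i,j)} ( ω_N(σ_i·σ_j) − ω_N(σ_i)·ω_N(σ_j) ) = 0. -/

import Mathlib

open Filter MeasureTheory

noncomputable section

/-- The value of a spin encoded by a Boolean: `+1` or `-1`. -/
def spin (b : Bool) : ℝ := if b then 1 else -1

/-- Magnetization of a configuration of `N` spins. -/
def mag (N : ℕ) (σ : Fin N → Bool) : ℝ := (∑ i, spin (σ i)) / N

/-- Curie-Weiss Hamiltonian. -/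
def ham (N : ℕ) (J h : ℝ) (σ : Fin N → Bool) : ℝ :=
  -(N * (J / 2 * mag N σ ^ 2 + h * mag N σ))

/-- Curie-Weiss partition function. -/
def Z (N : ℕ) (J h : ℝ) : ℝ := ∑ σ : Fin N → Bool, Real.exp (-ham N J h σ)

/-- Gibbs expectation of an observable `f`. -/
def gibbs (N : ℕ) (J h : ℝ) (f : (Fin N → Bool) → ℝ) : ℝ :=
  (∑ σ : Fin N → Bool, f σ * Real.exp (-ham N J h σ)) / Z N J h

/-- The spin observable at site `i` in a system of `N` spins (a junk value `0` is
used when `i ≥ N`; this only affects finitely many `N`, hence not the limit). -/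
def spinAt (N i : ℕ) (σ : Fin N → Bool) : ℝ :=
  if hi : i < N then spin (σ ⟨i, hi⟩) else 0

lemma spin_sq (b : Bool) : spin b * spin b = 1 := by cases b <;> simp [spin]

lemma spin_abs (b : Bool) : |spin b| = 1 := by cases b <;> simp [spin]

lemma mag_mul (N : ℕ) (σ : Fin N → Bool) : (N : ℝ) * mag N σ = ∑ i, spin (σ i) := by
  rcases Nat.eq_zero_or_pos N with rfl | hN
  · simp
  · have : (N : ℝ) ≠ 0 := by positivity
    unfold mag
    field_simp

lemma mag_abs (N : ℕ) (σ : Fin N → Bool) : |mag N σ| ≤ 1 := by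
  unfold mag
  rw [abs_div, Nat.abs_cast]
  apply div_le_one_of_le₀ _ (Nat.cast_nonneg N)
  calc |∑ i, spin (σ i)| ≤ ∑ i, |spin (σ i)| := Finset.abs_sum_le_sum_abs _ _
    _ = N := by simp [spin_abs]

lemma Z_pos (N : ℕ) (J h : ℝ) : 0 < Z N J h :=
  Finset.sum_pos (fun _ _ => Real.exp_pos _) Finset.univ_nonempty

lemma gibbs_add (N : ℕ) (J h : ℝ) (f g : (Fin N → Bool) → ℝ) :
    gibbs N J h (fun σ => f σ + g σ) = gibbs N J h f + gibbs N J h g := by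
  simp [gibbs, add_mul, Finset.sum_add_distrib, add_div]

lemma gibbs_const_mul (N : ℕ) (J h c : ℝ) (f : (Fin N → Bool) → ℝ) :
    gibbs N J h (fun σ => c * f σ) = c * gibbs N J h f := by
  simp [gibbs, mul_assoc, ← Finset.mul_sum, mul_div_assoc]

lemma gibbs_const (N : ℕ) (J h c : ℝ) :
    gibbs N J h (fun _ => c) = c := by
  unfold gibbs
  rw [← Finset.mul_sum]
  exact mul_div_cancel_right₀ c (Z_pos N J h).ne'

lemma gibbs_mono (N : ℕ) (J h : ℝ) (f g : (Fin N → Bool) → ℝ) (hfg : ∀ σ, f σ ≤ g σ) :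
    gibbs N J h f ≤ gibbs N J h g := by
  unfold gibbs
  apply div_le_div_of_nonneg_right _ (Z_pos N J h).le
  exact Finset.sum_le_sum fun σ _ => mul_le_mul_of_nonneg_right (hfg σ) (Real.exp_pos _).le

lemma gibbs_sum (N : ℕ) (J h : ℝ) {ι : Type} (s : Finset ι) (f : ι → (Fin N → Bool) → ℝ) :
    gibbs N J h (fun σ => ∑ k ∈ s, f k σ) = ∑ k ∈ s, gibbs N J h (f k) := by
  unfold gibbs
  rw [← Finset.sum_div, Finset.sum_comm]
  simp [Finset.sum_mul]

lemma mag_perm (N : ℕ) (π : Equiv.Perm (Fin N)) (σ : Fin N → Bool) :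
    mag N (fun k => σ (π k)) = mag N σ := by
  unfold mag
  rw [Equiv.sum_comp π (fun k => spin (σ k))]

lemma gibbs_perm (N : ℕ) (J h : ℝ) (π : Equiv.Perm (Fin N)) (f : (Fin N → Bool) → ℝ) :
    gibbs N J h (fun σ => f (fun k => σ (π k))) = gibbs N J h f := by
  unfold gibbs
  congr 1
  rw [← Equiv.sum_comp (Equiv.arrowCongr π.symm (Equiv.refl Bool))
    (fun σ => f σ * Real.exp (-ham N J h σ))]
  apply Finset.sum_congr rfl
  intro σ _
  have : (Equiv.arrowCongr π.symm (Equiv.refl Bool)) σ = fun k => σ (π k) := by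
    ext k; simp [Equiv.arrowCongr]
  rw [this]
  simp [ham, mag_perm]

lemma gibbs_site (N : ℕ) (J h : ℝ) (a : Fin N) :
    gibbs N J h (fun σ => spin (σ a)) = gibbs N J h (mag N) := by
  have hN : (N : ℝ) ≠ 0 := by
    have := a.pos
    positivity
  have h1 : ∀ b : Fin N, gibbs N J h (fun σ => spin (σ b)) = gibbs N J h (fun σ => spin (σ a)) := by
    intro b
    have := gibbs_perm N J h (Equiv.swap a b) (fun σ => spin (σ a))
    simpa using this
  have h2 := gibbs_sum N J h Finset.univ (fun (b : Fin N) σ => spin (σ b))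
  simp only [← mag_mul, h1, gibbs_const_mul] at h2
  simp at h2
  rcases h2 with h2 | h2
  · exact h2.symm
  · subst h2; exact a.elim0

lemma gibbs_site_mag (N : ℕ) (J h : ℝ) (a : Fin N) :
    gibbs N J h (fun σ => spin (σ a) * mag N σ) = gibbs N J h (fun σ => mag N σ * mag N σ) := by
  have hN : (N : ℝ) ≠ 0 := by
    have := a.pos
    positivity
  have h1 : ∀ b : Fin N, gibbs N J h (fun σ => spin (σ b) * mag N σ)
      = gibbs N J h (fun σ => spin (σ a) * mag N σ) := by
    intro b
    have := gibbs_perm N J h (Equiv.swap a b) (fun σ => spin (σ a) * mag N σ)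
    simpa [mag_perm] using this
  have h2 := gibbs_sum N J h Finset.univ (fun (b : Fin N) σ => spin (σ b) * mag N σ)
  simp only [← Finset.sum_mul, ← mag_mul, h1, mul_assoc, gibbs_const_mul] at h2
  rw [Finset.sum_const, Finset.card_univ, Fintype.card_fin, nsmul_eq_mul] at h2
  exact (mul_left_cancel₀ hN h2).symm

lemma gibbs_pair (N : ℕ) (J h : ℝ) (a b : Fin N) (hab : a ≠ b) :
    (N : ℝ) * gibbs N J h (fun σ => mag N σ * mag N σ)
      = 1 + (N - 1) * gibbs N J h (fun σ => spin (σ a) * spin (σ b)) := by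
  have h1 : ∀ c : Fin N, c ≠ a → gibbs N J h (fun σ => spin (σ a) * spin (σ c))
      = gibbs N J h (fun σ => spin (σ a) * spin (σ b)) := by
    intro c hc
    have := gibbs_perm N J h (Equiv.swap b c) (fun σ => spin (σ a) * spin (σ b))
    simpa [Equiv.swap_apply_of_ne_of_ne hab hc.symm] using this
  have h2 := gibbs_sum N J h Finset.univ (fun (c : Fin N) σ => spin (σ a) * spin (σ c))
  simp only [← Finset.mul_sum, ← mag_mul] at h2
  have h3 : (fun σ : Fin N → Bool => spin (σ a) * ((N : ℝ) * mag N σ))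
      = fun σ => (N : ℝ) * (spin (σ a) * mag N σ) := by
    ext σ; ring
  rw [h3, gibbs_const_mul, gibbs_site_mag] at h2
  rw [h2, ← Finset.add_sum_erase _ _ (Finset.mem_univ a)]
  simp only [spin_sq, gibbs_const]
  rw [Finset.sum_congr rfl (fun c hc => h1 c (Finset.ne_of_mem_erase hc))]
  rw [Finset.sum_const, Finset.card_erase_of_mem (Finset.mem_univ a), Finset.card_univ,
    Fintype.card_fin, nsmul_eq_mul, Nat.cast_sub a.pos]
  simp

lemma neg_ham_eq (N : ℕ) (J h : ℝ) (σ : Fin N → Bool) :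
    -ham N J h σ = J / 2 * (N * mag N σ ^ 2) + h * (N * mag N σ) := by
  unfold ham; ring

lemma mag_sq_append (m n : ℕ) (x : Fin m → Bool) (y : Fin n → Bool) :
    ((m + n : ℕ) : ℝ) * mag (m + n) (Fin.append x y) ^ 2
      ≤ m * mag m x ^ 2 + n * mag n y ^ 2 := by
  have hs : ((m + n : ℕ) : ℝ) * mag (m + n) (Fin.append x y) = m * mag m x + n * mag n y := by
    rw [mag_mul, mag_mul, mag_mul, Fin.sum_univ_add]
    simp
  push_cast at hs ⊢
  set M := mag (m + n) (Fin.append x y)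
  set A := mag m x
  set B := mag n y
  have hm : (0 : ℝ) ≤ m := Nat.cast_nonneg m
  have hn : (0 : ℝ) ≤ n := Nat.cast_nonneg n
  have hs2 : M * ((m + n) * M) = M * (m * A + n * B) := by rw [hs]
  nlinarith [mul_nonneg hm (sq_nonneg (A - M)), mul_nonneg hn (sq_nonneg (B - M))]

lemma Z_submul (m n : ℕ) (J h : ℝ) (hJ : 0 ≤ J) : Z (m + n) J h ≤ Z m J h * Z n J h := by
  unfold Z
  rw [Finset.sum_mul_sum, ← Equiv.sum_comp (Fin.appendEquiv m n), Fintype.sum_prod_type]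
  apply Finset.sum_le_sum; intro x _
  apply Finset.sum_le_sum; intro y _
  rw [← Real.exp_add]
  apply Real.exp_le_exp.mpr
  have hs : ((m + n : ℕ) : ℝ) * mag (m + n) (Fin.append x y) = m * mag m x + n * mag n y := by
    rw [mag_mul, mag_mul, mag_mul, Fin.sum_univ_add]
    simp
  have h2 := mag_sq_append m n x y
  show -ham (m + n) J h (Fin.append x y) ≤ _
  rw [neg_ham_eq, neg_ham_eq, neg_ham_eq, hs]
  nlinarith

lemma Z_lip (N : ℕ) (J h k : ℝ) : Real.log (Z N J k) ≤ Real.log (Z N J h) + N * |k - h| := by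
  rw [← Real.log_exp (N * |k - h|), ← Real.log_mul (Z_pos _ _ _).ne' (Real.exp_pos _).ne']
  apply Real.log_le_log (Z_pos _ _ _)
  unfold Z
  rw [Finset.sum_mul]
  apply Finset.sum_le_sum; intro σ _
  rw [← Real.exp_add]
  apply Real.exp_le_exp.mpr
  rw [neg_ham_eq, neg_ham_eq]
  have h1 : (k - h) * mag N σ ≤ |k - h| := by
    calc _ ≤ |(k - h) * mag N σ| := le_abs_self _
      _ = |k - h| * |mag N σ| := abs_mul _ _
      _ ≤ |k - h| * 1 := by gcongr; exact mag_abs N σ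
      _ = _ := mul_one _
  nlinarith [mul_le_mul_of_nonneg_left h1 (Nat.cast_nonneg (α := ℝ) N)]

lemma log_Z_lower (N : ℕ) (J h : ℝ) (hJ : 0 ≤ J) : -(N * |h|) ≤ Real.log (Z N J h) := by
  have h0 : 0 ≤ Real.log (Z N J 0) := by
    apply Real.log_nonneg
    have : Real.exp (-ham N J 0 (fun _ => true)) ≤ Z N J 0 :=
      Finset.single_le_sum (f := fun σ => Real.exp (-ham N J 0 σ))
        (fun _ _ => (Real.exp_pos _).le) (Finset.mem_univ _)
    refine le_trans (Real.one_le_exp ?_) this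
    rw [neg_ham_eq]
    rw [zero_mul, add_zero]
    positivity
  have := Z_lip N J h 0
  simp only [zero_sub, abs_neg] at this
  linarith

lemma pressure_tendsto (J h : ℝ) (hJ : 0 ≤ J) :
    ∃ l, Tendsto (fun N : ℕ => Real.log (Z N J h) / N) atTop (nhds l) := by
  have hsub : Subadditive (fun N : ℕ => Real.log (Z N J h)) := by
    intro m n
    rw [← Real.log_mul (Z_pos _ _ _).ne' (Z_pos _ _ _).ne']
    exact Real.log_le_log (Z_pos _ _ _) (Z_submul m n J h hJ)
  refine ⟨_, hsub.tendsto_lim ⟨-|h|, ?_⟩⟩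
  rintro _ ⟨N, rfl⟩
  rcases Nat.eq_zero_or_pos N with rfl | hN
  · simp
  · have hN' : (0 : ℝ) < N := by positivity
    show -|h| ≤ Real.log (Z N J h) / N
    rw [le_div_iff₀ hN']
    linarith [log_Z_lower N J h hJ]

/-- Exponential moment of the magnetization. -/
lemma gibbs_exp (N : ℕ) (J h t a : ℝ) :
    gibbs N J h (fun σ => Real.exp (N * (t * mag N σ - a)))
      = Real.exp (Real.log (Z N J (h + t)) - Real.log (Z N J h) - N * a) := by
  rw [Real.exp_sub, Real.exp_sub, Real.exp_log (Z_pos _ _ _), Real.exp_log (Z_pos _ _ _)]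
  unfold gibbs
  rw [div_right_comm]
  congr 1
  rw [Z, Finset.sum_div]
  apply Finset.sum_congr rfl
  intro σ _
  rw [← Real.exp_add, ← Real.exp_sub, neg_ham_eq, neg_ham_eq]
  congr 1
  ring

lemma gibbs_exp_tendsto (J : ℝ) (p : ℝ → ℝ)
    (hp : ∀ h, Tendsto (fun N : ℕ => Real.log (Z N J h) / N) atTop (nhds (p h)))
    (h t a : ℝ) (ha : p (h + t) - p h < a) :
    Tendsto (fun N : ℕ => gibbs N J h (fun σ => Real.exp (N * (t * mag N σ - a))))
      atTop (nhds 0) := by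
  simp only [gibbs_exp]
  apply Real.tendsto_exp_atBot.comp
  have h1 : Tendsto (fun N : ℕ => Real.log (Z N J (h + t)) / N - Real.log (Z N J h) / N - a)
      atTop (nhds (p (h + t) - p h - a)) := ((hp _).sub (hp _)).sub_const a
  have h2 := (tendsto_natCast_atTop_atTop (R := ℝ)).atTop_mul_neg (by linarith) h1
  refine h2.congr' ?_
  filter_upwards [eventually_gt_atTop 0] with N hN
  have : (N : ℝ) ≠ 0 := by positivity
  field_simp

lemma var_tendsto (J : ℝ) (p : ℝ → ℝ)
    (hp : ∀ h, Tendsto (fun N : ℕ => Real.log (Z N J h) / N) atTop (nhds (p h)))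
    (h : ℝ) (hd : DifferentiableAt ℝ p h) :
    Tendsto (fun N : ℕ => gibbs N J h (fun σ => (mag N σ - deriv p h) ^ 2)) atTop (nhds 0) := by
  set c := deriv p h with hc
  have hder : HasDerivAt p c h := hd.hasDerivAt
  set K := (1 + |c|) ^ 2 with hK
  have hKpos : 0 < K := by positivity
  have key : ∀ ε > 0, ∃ t > 0, p (h + t) - p h < t * (c + ε) ∧ p (h + -t) - p h < t * (-c + ε) := by
    intro ε hε
    have h1 := (hasDerivAt_iff_isLittleO_nhds_zero.mp hder).def (half_pos hε)
    obtain ⟨δ, hδ, hball⟩ := Metric.eventually_nhds_iff.mp h1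
    refine ⟨δ / 2, by positivity, ?_, ?_⟩
    · have := hball (y := δ / 2) (by simp [abs_of_pos hδ]; linarith)
      simp only [Real.norm_eq_abs, smul_eq_mul, abs_of_pos (half_pos hδ)] at this
      have := (abs_le.mp this).2
      nlinarith [mul_pos hδ hε]
    · have := hball (y := -(δ / 2)) (by simp [abs_of_pos hδ]; linarith)
      simp only [Real.norm_eq_abs, smul_eq_mul, abs_neg, abs_of_pos (half_pos hδ)] at this
      have := (abs_le.mp this).2
      nlinarith [mul_pos hδ hε]
  rw [Metric.tendsto_atTop]
  intro η hη
  obtain ⟨ε, hε, hεη⟩ : ∃ ε > 0, ε ^ 2 = η / 2 := ⟨√(η / 2), by positivity, Real.sq_sqrt (by positivity)⟩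
  obtain ⟨t, ht, h1, h2⟩ := key ε hε
  have T := ((gibbs_exp_tendsto J p hp h t _ h1).add
    (gibbs_exp_tendsto J p hp h (-t) _ h2)).const_mul K
  simp only [add_zero, mul_zero] at T
  obtain ⟨N0, hN0⟩ := Filter.eventually_atTop.mp (T.eventually (gt_mem_nhds (half_pos hη)))
  refine ⟨N0, fun N hN => ?_⟩
  have hlt := hN0 N hN
  rw [← gibbs_add, ← gibbs_const_mul] at hlt
  have hnn : 0 ≤ gibbs N J h (fun σ => (mag N σ - c) ^ 2) := by
    rw [← gibbs_const N J h 0]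
    exact gibbs_mono _ _ _ _ _ fun σ => sq_nonneg _
  rw [Real.dist_eq, sub_zero, abs_of_nonneg hnn]
  have hle := gibbs_mono N J h (fun σ => (mag N σ - c) ^ 2)
    (fun σ => ε ^ 2 + K * (Real.exp (N * (t * mag N σ - t * (c + ε)))
      + Real.exp (N * (-t * mag N σ - t * (-c + ε))))) (by
    intro σ
    have e1 := Real.exp_pos (N * (t * mag N σ - t * (c + ε)))
    have e2 := Real.exp_pos (N * (-t * mag N σ - t * (-c + ε)))
    have hb : (mag N σ - c) ^ 2 ≤ K := by
      rw [hK]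
      apply sq_le_sq'
      · linarith [(abs_le.mp (mag_abs N σ)).1, le_abs_self c]
      · linarith [(abs_le.mp (mag_abs N σ)).2, neg_abs_le c]
    have hN' : (0 : ℝ) ≤ N := Nat.cast_nonneg N
    by_cases c1 : c + ε ≤ mag N σ
    · have : 1 ≤ Real.exp (N * (t * mag N σ - t * (c + ε))) := by
        apply Real.one_le_exp
        rw [← mul_sub]
        exact mul_nonneg hN' (mul_nonneg ht.le (by linarith))
      nlinarith [sq_nonneg ε]
    by_cases c2 : mag N σ ≤ c - ε
    · have : 1 ≤ Real.exp (N * (-t * mag N σ - t * (-c + ε))) := by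
        apply Real.one_le_exp
        have : -t * mag N σ - t * (-c + ε) = t * (c - ε - mag N σ) := by ring
        rw [this]
        exact mul_nonneg hN' (mul_nonneg ht.le (by linarith))
      nlinarith [sq_nonneg ε]
    have : (mag N σ - c) ^ 2 ≤ ε ^ 2 := sq_le_sq' (by linarith) (by linarith)
    have : 0 ≤ K * (Real.exp (N * (t * mag N σ - t * (c + ε)))
      + Real.exp (N * (-t * mag N σ - t * (-c + ε)))) := by positivity
    linarith)
  rw [gibbs_add, gibbs_const] at hle
  linarith

lemma var_bounds (N : ℕ) (J h c : ℝ) :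
    |gibbs N J h (fun σ => mag N σ * mag N σ) - gibbs N J h (mag N) * gibbs N J h (mag N)|
      ≤ gibbs N J h (fun σ => (mag N σ - c) ^ 2) := by
  have e : ∀ c, gibbs N J h (fun σ => (mag N σ - c) ^ 2)
      = gibbs N J h (fun σ => mag N σ * mag N σ) + (-2 * c * gibbs N J h (mag N) + c ^ 2) := by
    intro c
    rw [← gibbs_const N J h (c ^ 2), ← gibbs_const_mul, ← gibbs_add, ← gibbs_add]
    congr 1; ext σ; ring
  have hnn : 0 ≤ gibbs N J h (fun σ => (mag N σ - gibbs N J h (mag N)) ^ 2) := by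
    conv_lhs => rw [← gibbs_const N J h 0]
    exact gibbs_mono _ _ _ _ _ fun σ => sq_nonneg _
  rw [e] at hnn ⊢
  rw [abs_of_nonneg (by linarith)]
  nlinarith [sq_nonneg (gibbs N J h (mag N) - c)]

/-- For fixed `J ≥ 0`, distinct sites `i ≠ j`, and Lebesgue-almost every `h`, the
two-point correlation function factorizes in the thermodynamic limit `N → ∞`. -/
theorem curieWeiss_twoPoint_factorization (J : ℝ) (hJ : 0 ≤ J) (i j : ℕ) (hij : i ≠ j) :
    ∀ᵐ h ∂(volume : Measure ℝ),
      Tendsto (fun N : ℕ =>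
          gibbs N J h (fun σ => spinAt N i σ * spinAt N j σ)
            - gibbs N J h (spinAt N i) * gibbs N J h (spinAt N j))
        atTop (nhds 0) := by
  choose p hp using fun h => pressure_tendsto J h hJ
  have hlip : LipschitzWith 1 p := by
    apply LipschitzWith.of_le_add
    intro x y
    refine le_of_tendsto_of_tendsto (hp x) ((hp y).add_const _) ?_
    filter_upwards [eventually_gt_atTop 0] with N hN
    have hN' : (0 : ℝ) < N := by positivity
    rw [div_le_iff₀ hN', add_mul, div_mul_cancel₀ _ hN'.ne', Real.dist_eq]
    linarith [Z_lip N J y x]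
  filter_upwards [hlip.ae_differentiableAt_real] with h hd
  have hv := var_tendsto J p hp h hd
  have h2N : Tendsto (fun N : ℕ => (2 : ℝ) / N) atTop (nhds 0) :=
    tendsto_const_div_atTop_nhds_zero_nat 2
  have hsum := hv.add h2N
  rw [add_zero] at hsum
  apply squeeze_zero_norm' _ hsum
  filter_upwards [eventually_gt_atTop i, eventually_gt_atTop j] with N hi hj
  have hN' : (0 : ℝ) < N := by
    have : 0 < N := by omega
    positivity
  have hne : (⟨i, hi⟩ : Fin N) ≠ ⟨j, hj⟩ := by simpa using hij
  have e1 : spinAt N i = fun σ => spin (σ ⟨i, hi⟩) := by ext σ; simp [spinAt, hi]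
  have e2 : spinAt N j = fun σ => spin (σ ⟨j, hj⟩) := by ext σ; simp [spinAt, hj]
  simp only [e1, e2, gibbs_site]
  have hpair := gibbs_pair N J h _ _ hne
  have hvb := var_bounds N J h (deriv p h)
  set q := gibbs N J h (fun σ => spin (σ ⟨i, hi⟩) * spin (σ ⟨j, hj⟩)) with hq
  have habs : ∀ σ : Fin N → Bool, |spin (σ ⟨i, hi⟩) * spin (σ ⟨j, hj⟩)| ≤ 1 := by
    intro σ; rw [abs_mul, spin_abs, spin_abs, mul_one]
  have hq1 : q ≤ 1 := by
    have := gibbs_mono N J h _ (fun _ => 1) (fun σ => (abs_le.mp (habs σ)).2)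
    rwa [gibbs_const] at this
  have hq2 : -1 ≤ q := by
    have := gibbs_mono N J h (fun _ => -1) _ (fun σ => (abs_le.mp (habs σ)).1)
    rwa [gibbs_const] at this
  have hdiff : q = gibbs N J h (fun σ => mag N σ * mag N σ) + (q - 1) / N := by
    have : (q - 1) / N * N = q - 1 := div_mul_cancel₀ _ hN'.ne'
    apply mul_left_cancel₀ hN'.ne'
    linarith
  have hb : |(q - 1) / N| ≤ 2 / N := by
    rw [abs_div, Nat.abs_cast]
    apply div_le_div_of_nonneg_right _ hN'.le
    rw [abs_le]; constructor <;> linarith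
  rw [Real.norm_eq_abs, hdiff, add_sub_right_comm]
  exact (abs_add_le _ _).trans (add_le_add hvb hb)
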